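/- Let p be a prime, let G be a finite powerful p-group and let H be a subgroup of G. Then the minimal number of generators of H is at most the minimal number of generators of G, i.e. d(H) ≤ d(G). -/

import Mathlib

/-- The subgroup `G^n` of `G` generated by the `n`-th powers of elements of `G`. -/
def powerSubgroup (G : Type*) [Group G] (n : ℕ) : Subgroup G :=
  Subgroup.closure {x : G | ∃ g : G, g ^ n = x}

/-- A finite `p`-group `G` is *powerful* if `[G,G] ≤ G^p` for `p` odd, and
`[G,G] ≤ G^4` for `p = 2`. -/
def IsPowerful (p : ℕ) (G : Type*) [Group G] : Prop :=
  if p = 2 then commutator G ≤ powerSubgroup G 4 else commutator G ≤ powerSubgroup G p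

namespace Subgroup

variable {G G' : Type*} [Group G] [Group G']

/-- The subgroup generated by the `n`-th powers of the elements of a subgroup `H`. -/
def powClosure (H : Subgroup G) (n : ℕ) : Subgroup G :=
  closure ((fun x => x ^ n) '' (H : Set G))

theorem pow_mem_powClosure {H : Subgroup G} {x : G} (hx : x ∈ H) (n : ℕ) :
    x ^ n ∈ H.powClosure n :=
  subset_closure ⟨x, hx, rfl⟩

theorem powClosure_le {H K : Subgroup G} {n : ℕ} :
    H.powClosure n ≤ K ↔ ∀ x ∈ H, x ^ n ∈ K := by
  simp [powClosure, closure_le, Set.subset_def]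

theorem powClosure_le_self (H : Subgroup G) (n : ℕ) : H.powClosure n ≤ H :=
  powClosure_le.2 fun _ hx => pow_mem hx n

theorem powClosure_mono {H K : Subgroup G} (h : H ≤ K) (n : ℕ) :
    H.powClosure n ≤ K.powClosure n :=
  powClosure_le.2 fun _ hx => pow_mem_powClosure (h hx) n

theorem powClosure_mul_le (H : Subgroup G) (m n : ℕ) :
    H.powClosure (m * n) ≤ (H.powClosure m).powClosure n :=
  powClosure_le.2 fun x hx => pow_mul x m n ▸ pow_mem_powClosure (pow_mem_powClosure hx m) n

theorem map_powClosure (f : G →* G') (H : Subgroup G) (n : ℕ) :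
    (H.powClosure n).map f = (H.map f).powClosure n := by
  simp only [powClosure, MonoidHom.map_closure, coe_map, Set.image_image, map_pow]

instance powClosure_normal (H : Subgroup G) [hH : H.Normal] (n : ℕ) : (H.powClosure n).Normal := by
  refine ⟨fun x hx g => ?_⟩
  have : (H.powClosure n).map (MulAut.conj g).toMonoidHom ≤ H.powClosure n := by
    rw [map_powClosure]
    refine powClosure_mono ?_ n
    rintro _ ⟨y, hy, rfl⟩
    exact hH.conj_mem y hy g
  exact this ⟨x, hx, rfl⟩

/-- The subgroup `[H, H] H ^ p`, which for a finite `p`-group `H` is its Frattini subgroup. -/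
def pFrattini (p : ℕ) (H : Subgroup G) : Subgroup G :=
  ⁅H, H⁆ ⊔ H.powClosure p

theorem pFrattini_le_self (p : ℕ) (H : Subgroup G) : H.pFrattini p ≤ H :=
  sup_le H.commutator_le_self (H.powClosure_le_self p)

theorem pFrattini_mono (p : ℕ) {H K : Subgroup G} (h : H ≤ K) : H.pFrattini p ≤ K.pFrattini p :=
  sup_le_sup (commutator_mono h h) (powClosure_mono h p)

theorem map_pFrattini (p : ℕ) (f : G →* G') (H : Subgroup G) :
    (H.pFrattini p).map f = (H.map f).pFrattini p := by
  simp only [pFrattini, map_sup, map_commutator, map_powClosure]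

instance pFrattini_normal (p : ℕ) (H : Subgroup G) [H.Normal] : (H.pFrattini p).Normal := by
  unfold pFrattini; infer_instance

/-- A normal subgroup `A` of a nilpotent group with `A ≤ B [A, G]` satisfies `A ≤ B`. -/
theorem le_of_le_sup_commutator_top [Group.IsNilpotent G] {A B : Subgroup G} [B.Normal]
    (h : A ≤ B ⊔ ⁅A, ⊤⁆) : A ≤ B := by
  obtain ⟨n, hn⟩ := Subgroup.nilpotent_iff_lowerCentralSeries.1
    (inferInstance : Group.IsNilpotent (G ⧸ B))
  have hA : A.map (QuotientGroup.mk' B) ≤ ⁅A.map (QuotientGroup.mk' B), ⊤⁆ := by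
    have := map_mono (f := QuotientGroup.mk' B) h
    rwa [map_sup, map_commutator, QuotientGroup.map_mk'_self, bot_sup_eq,
      map_top_of_surjective _ (QuotientGroup.mk'_surjective B)] at this
  have key : ∀ k, A.map (QuotientGroup.mk' B) ≤ (⊤ : Subgroup (G ⧸ B)).lowerCentralSeries k := by
    intro k
    induction k with
    | zero => exact le_top
    | succ k ih => exact hA.trans (commutator_mono ih le_rfl)
  have := key n
  rwa [hn, le_bot_iff, map_eq_bot_iff, QuotientGroup.ker_mk'] at this

end Subgroup

open Subgroup

theorem AddCommGroup.exists_finset_closure_eq_top {V : Type*} [AddCommGroup V] [Finite V] {p : ℕ}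
    [Fact p.Prime] [Module (ZMod p) V] :
    ∃ S : Finset V, AddSubgroup.closure (S : Set V) = ⊤ ∧ Nat.card V = p ^ S.card := by
  classical
  let b := Module.finBasis (ZMod p) V
  refine ⟨Finset.univ.image b, eq_top_iff.2 ?_, ?_⟩
  · set K := AddSubgroup.closure ((Finset.univ.image b : Finset V) : Set V)
    have h : ⊤ ≤ AddSubgroup.toZModSubmodule p K := by
      rw [← b.span_eq, Submodule.span_le]
      rintro _ ⟨i, rfl⟩
      exact AddSubgroup.subset_closure (by simp)
    exact fun x _ => h (Submodule.mem_top (x := x))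
  · rw [Finset.card_image_of_injective _ b.injective, Finset.card_univ, Fintype.card_fin,
      Module.natCard_eq_pow_finrank (K := ZMod p), Nat.card_zmod]

theorem CommGroup.pow_rank_eq_card_of_pow_eq_one {E : Type*} [CommGroup E] [Finite E] {p : ℕ}
    (hp : p.Prime) (hE : ∀ x : E, x ^ p = 1) : p ^ Group.rank E = Nat.card E := by
  classical
  have := Fact.mk hp
  apply le_antisymm
  · let := AddCommGroup.zmodModule (G := Additive E) (n := p) hE
    obtain ⟨S, hS, hcard⟩ := AddCommGroup.exists_finset_closure_eq_top (V := Additive E) (p := p)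
    have hT : closure ((S.map Additive.toMul.toEmbedding : Finset E) : Set E) = ⊤ := by
      rw [← Subgroup.toAddSubgroup.injective.eq_iff, Subgroup.toAddSubgroup_closure, map_top, ← hS]
      congr 1
      ext x
      simp
    change _ ≤ Nat.card (Additive E)
    rw [hcard]
    exact Nat.pow_le_pow_right hp.pos ((Group.rank_le hT).trans_eq (Finset.card_map _))
  · exact Nat.le_of_dvd (pow_pos hp.pos _) (card_dvd_exponent_pow_rank' E hE)

namespace IsPGroup

variable {p : ℕ} {G : Type*} [Group G] [Finite G]

theorem pFrattini_le_of_isCoatom (hp : p.Prime) (hG : IsPGroup p G) {M : Subgroup G}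
    (hM : IsCoatom M) : (⊤ : Subgroup G).pFrattini p ≤ M := by
  have := Fact.mk hp
  have := hG.isNilpotent
  have hn : M.Normal := Group.normalizerCondition_of_isNilpotent.normal_of_coatom M hM
  have hQ : IsPGroup p (G ⧸ M) := hG.to_quotient M
  have : Nontrivial (G ⧸ M) := QuotientGroup.nontrivial_iff.2 hM.1
  have hs : IsSimpleGroup (G ⧸ M) := by
    refine ⟨fun K _ => ?_⟩
    have hK : M ≤ K.comap (QuotientGroup.mk' M) := by
      simpa using K.ker_le_comap (QuotientGroup.mk' M)
    have hinj := comap_injective (QuotientGroup.mk'_surjective M)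
    rcases hM.le_iff.1 hK with h | h
    · right; apply hinj; simpa using h
    · left; apply hinj; simpa using h
  have hc : center (G ⧸ M) = ⊤ :=
    (Normal.eq_bot_or_eq_top (inferInstance : (center (G ⧸ M)).Normal)).resolve_left
      hQ.bot_lt_center.ne'
  have hcomm : IsMulCommutative (G ⧸ M) :=
    (commutator_eq_bot_iff _).1 ((commutator_eq_bot_iff_center_eq_top _).2 hc)
  let : CommGroup (G ⧸ M) := { mul_comm := hcomm.is_comm.comm }
  have hcard : Nat.card (G ⧸ M) = p := by
    have := IsSimpleGroup.prime_card (α := G ⧸ M)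
    rcases hQ.card_eq_or_dvd with h | h
    · exact absurd this (h ▸ Nat.not_prime_one)
    · exact ((Nat.prime_dvd_prime_iff_eq hp this).1 h).symm
  refine sup_le (Subgroup.Normal.quotient_commutative_iff_commutator_le.1 hcomm)
    (powClosure_le.2 fun x _ => ?_)
  rw [← QuotientGroup.eq_one_iff, QuotientGroup.mk_pow, ← hcard, pow_card_eq_one']

theorem eq_top_of_sup_pFrattini (hp : p.Prime) (hG : IsPGroup p G) {K : Subgroup G}
    (h : K ⊔ (⊤ : Subgroup G).pFrattini p = ⊤) : K = ⊤ := by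
  refine frattini_nongenerating (top_le_iff.1 (h.ge.trans (sup_le_sup_left ?_ K)))
  exact le_iInf₂ fun M hM => hG.pFrattini_le_of_isCoatom hp hM

/-- The Burnside basis theorem. -/
theorem pow_rank_eq_index_pFrattini (hp : p.Prime) (hG : IsPGroup p G) :
    p ^ Group.rank G = ((⊤ : Subgroup G).pFrattini p).index := by
  classical
  have := Fact.mk hp
  set F := (⊤ : Subgroup G).pFrattini p
  have hcomm : IsMulCommutative (G ⧸ F) :=
    Subgroup.Normal.quotient_commutative_iff_commutator_le.2 le_sup_left
  have hexp : ∀ x : G ⧸ F, x ^ p = 1 := by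
    rintro ⟨x⟩
    exact (QuotientGroup.eq_one_iff (x ^ p)).2
      (mem_sup_right (pow_mem_powClosure (mem_top x) p))
  let : CommGroup (G ⧸ F) := { mul_comm := hcomm.is_comm.comm }
  rw [Subgroup.index, ← CommGroup.pow_rank_eq_card_of_pow_eq_one hp hexp]
  congr 1
  refine le_antisymm ?_ (Group.rank_le_of_surjective _ (QuotientGroup.mk'_surjective F))
  obtain ⟨S, hS, hS'⟩ := Group.rank_spec (G ⧸ F)
  have hT : closure ((S.image Quotient.out : Finset G) : Set G) = ⊤ := by
    apply hG.eq_top_of_sup_pFrattini hp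
    have h := comap_map_eq (QuotientGroup.mk' F) (closure ((S.image Quotient.out : Finset G) : Set G))
    rw [QuotientGroup.ker_mk', MonoidHom.map_closure, Finset.coe_image, Set.image_image] at h
    rw [Finset.coe_image]
    exact h.symm.trans (by simp [hS'])
  rw [← hS]
  exact (Group.rank_le hT).trans Finset.card_image_le

end IsPGroup

open scoped commutatorElement

theorem pow_mul_of_mul_comm_eq_center_mul {G : Type*} [Group G] {a b z : G} (hz : z ∈ center G)
    (h : b * a = z * (a * b)) (n : ℕ) : b ^ n * a = z ^ n * (a * b ^ n) := by
  have hzc : ∀ g : G, g * z = z * g := mem_center_iff.1 hz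
  induction n with
  | zero => simp
  | succ n ih =>
    calc b ^ (n + 1) * a = b ^ n * (b * a) := by rw [pow_succ, mul_assoc]
      _ = b ^ n * z * a * b := by rw [h]; group
      _ = z * (b ^ n * a) * b := by rw [hzc]; group
      _ = z ^ (n + 1) * (a * b ^ (n + 1)) := by rw [ih, pow_succ', pow_succ]; group

theorem commute_pow_of_mul_comm_eq_center_mul {G : Type*} [Group G] {a b z : G}
    (hz : z ∈ center G) (h : b * a = z * (a * b)) {n : ℕ} (hn : z ^ n = 1) :
    Commute b (a ^ n) := by
  have hs : SemiconjBy b a (z * a) := by rw [SemiconjBy, h, mul_assoc]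
  have := hs.pow_right n
  have hc : Commute z a := (mem_center_iff.1 hz a).symm
  rwa [hc.mul_pow, hn, one_mul] at this

/-- In a group of class two, `(ab)^n = [b, a] ^ (n choose 2) a^n b^n`. -/
theorem mul_pow_of_mul_comm_eq_center_mul {G : Type*} [Group G] {a b z : G} (hz : z ∈ center G)
    (h : b * a = z * (a * b)) (n : ℕ) : (a * b) ^ n = z ^ n.choose 2 * (a ^ n * b ^ n) := by
  have hzc : ∀ (k : ℕ) (g : G), g * z ^ k = z ^ k * g := fun k => mem_center_iff.1 (pow_mem hz k)
  have hb := pow_mul_of_mul_comm_eq_center_mul hz h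
  induction n with
  | zero => simp
  | succ n ih =>
    calc (a * b) ^ (n + 1) = z ^ n.choose 2 * a ^ n * (b ^ n * a) * b := by
          rw [pow_succ, ih]; group
      _ = z ^ n.choose 2 * (a ^ n * z ^ n) * a * b ^ n * b := by rw [hb]; group
      _ = z ^ (n.choose 2 + n) * (a ^ (n + 1) * b ^ (n + 1)) := by
          rw [hzc, pow_add, pow_succ a, pow_succ b]; group
      _ = z ^ (n + 1).choose 2 * (a ^ (n + 1) * b ^ (n + 1)) := by
          rw [Nat.choose_succ_succ' n 1, Nat.choose_one_right, add_comm]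

theorem mul_eq_commutatorElement_mul {G : Type*} [Group G] (a b : G) :
    b * a = ⁅b, a⁆ * (a * b) := by
  rw [commutatorElement_def]; group

theorem pow_choose_two_eq_one {G : Type*} [Group G] {p : ℕ} (hp : p.Prime) (h2 : p ≠ 2) {z : G}
    (hz : z ^ p = 1) : z ^ p.choose 2 = 1 := by
  obtain ⟨k, hk⟩ := hp.dvd_choose_self two_ne_zero (lt_of_le_of_ne hp.two_le h2.symm)
  rw [hk, pow_mul, hz, one_pow]

/-- The exponent in the definition of powerful `p`-groups. -/
def powerfulExponent (p : ℕ) : ℕ := if p = 2 then 4 else p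

namespace Subgroup

variable {G : Type*} [Group G] {p : ℕ}

theorem powClosure_powerfulExponent_le (H : Subgroup G) (p : ℕ) :
    H.powClosure (powerfulExponent p) ≤ H.powClosure p := by
  unfold powerfulExponent
  split_ifs with h
  · subst h
    exact (H.powClosure_mul_le 2 2).trans (powClosure_le_self _ 2)
  · exact le_rfl

theorem commutator_powClosure_eq_bot (hp : p.Prime)
    (h : _root_.commutator G ≤ (⊤ : Subgroup G).powClosure (powerfulExponent p))
    (hexp : ((⊤ : Subgroup G).powClosure p).powClosure (powerfulExponent p) = ⊥)
    (hc : ⁅(⊤ : Subgroup G).powClosure p, (⊤ : Subgroup G)⁆ ≤ center G) :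
    ⁅(⊤ : Subgroup G).powClosure p, (⊤ : Subgroup G)⁆ = ⊥ := by
  have hP : ∀ x g : G, ⁅x, g⁆ ∈ (⊤ : Subgroup G).powClosure (powerfulExponent p) := fun x g =>
    h (commutator_mem_commutator (H₁ := ⊤) (H₂ := ⊤) (mem_top x) (mem_top g))
  have hx : ∀ x ∈ (⊤ : Subgroup G).powClosure p, x ^ powerfulExponent p = 1 := fun x hx =>
    mem_bot.1 (hexp ▸ pow_mem_powClosure hx _)
  have hz : ∀ x ∈ (⊤ : Subgroup G).powClosure p, ∀ g, ⁅x, g⁆ ∈ center G := fun x hx g =>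
    hc (commutator_mem_commutator hx (mem_top g))
  have hz' : ∀ x ∈ (⊤ : Subgroup G).powClosure p, ∀ g, ⁅g, x⁆ ∈ center G := fun x hx g => by
    rw [← commutatorElement_inv]; exact inv_mem (hz x hx g)
  have hle := powClosure_powerfulExponent_le (⊤ : Subgroup G) p
  suffices ∀ x g : G, (⁅g, x⁆ * x) ^ p = x ^ p by
    rw [commutator_top_right_eq_bot_iff_le_center]
    refine powClosure_le.2 fun x _ => mem_center_iff.2 fun g => ?_
    have h1 : ⁅g, x⁆ * x = g * x * g⁻¹ := by rw [commutatorElement_def]; group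
    have := this x g
    rw [h1, conj_pow] at this
    exact mul_inv_eq_iff_eq_mul.1 this
  by_cases h2 : p = 2
  · subst h2
    have he : powerfulExponent 2 = 4 := rfl
    rw [he] at hP hx hle
    -- the subgroup generated by fourth powers is elementary abelian
    have hcomm : ∀ x y : G, Commute (x ^ 4) (y ^ 4) := by
      intro x y
      have hx2 := pow_mem_powClosure (mem_top x) 2
      have h1 := mul_eq_commutatorElement_mul (y ^ 2) (x ^ 2)
      have hw := hz _ hx2 (y ^ 2)
      have hw4 := hx _ (hle (hP (x ^ 2) (y ^ 2)))
      have h2 := pow_mul_of_mul_comm_eq_center_mul hw h1 2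
      have h3 := commute_pow_of_mul_comm_eq_center_mul (pow_mem hw 2) h2 (n := 2)
        (by rw [← pow_mul, hw4])
      rwa [← pow_mul, ← pow_mul] at h3
    have hsq : ∀ c ∈ (⊤ : Subgroup G).powClosure 4, c ^ 2 = 1 := by
      have hcent : ∀ c ∈ (⊤ : Subgroup G).powClosure 4, ∀ y : G, Commute (y ^ 4) c :=
        fun c hc y => (mem_centralizer_singleton_iff.1 ((powClosure_le.2 fun x _ =>
          mem_centralizer_singleton_iff.2 (hcomm x y).eq) hc)).symm
      have hcent' : ∀ c ∈ (⊤ : Subgroup G).powClosure 4, ∀ d ∈ (⊤ : Subgroup G).powClosure 4,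
          Commute d c := fun c hc d hd =>
        mem_centralizer_singleton_iff.1 ((powClosure_le.2 fun x _ =>
          mem_centralizer_singleton_iff.2 (hcent c hc x).eq) hd)
      intro c hc
      induction hc using closure_induction with
      | one => exact one_pow 2
      | mem c hc =>
        obtain ⟨y, -, rfl⟩ := hc
        have := hx _ (pow_mem_powClosure (mem_top y) 2)
        rw [← pow_mul] at this ⊢
        exact this
      | mul c d hc hd hc2 hd2 => rw [(hcent' d hd c hc).mul_pow, hc2, hd2, one_mul]
      | inv c hc hc2 => rw [inv_pow, hc2, inv_one]
    have hcen : ∀ c ∈ (⊤ : Subgroup G).powClosure 4, ∀ x : G, ⁅x, c⁆ = 1 := by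
      have : (⊤ : Subgroup G).powClosure 4 ≤ center G := by
        refine powClosure_le.2 fun x _ => mem_center_iff.2 fun g => ?_
        have := commute_pow_of_mul_comm_eq_center_mul
          (hz' _ (pow_mem_powClosure (mem_top x) 2) g) (mul_eq_commutatorElement_mul _ _)
          (hsq _ (hP _ _))
        rwa [← pow_mul] at this
      exact fun c hc x => commutatorElement_eq_one_iff_mul_comm.2 (mem_center_iff.1 (this hc) x)
    intro x g
    have hcx := mul_eq_commutatorElement_mul ⁅g, x⁆ x
    rw [hcen _ (hP g x)] at hcx
    rw [mul_pow_of_mul_comm_eq_center_mul (one_mem _) hcx, one_pow, one_mul, hsq _ (hP g x),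
      one_mul]
  · have he : powerfulExponent p = p := if_neg h2
    rw [he] at hP hx
    intro x g
    rw [mul_pow_of_mul_comm_eq_center_mul (hz' _ (hP g x) x) (mul_eq_commutatorElement_mul _ _),
      pow_choose_two_eq_one hp h2 (hx _ (hP _ _)), hx _ (hP g x), one_mul, one_mul]

theorem commutator_powClosure_le [Group.IsNilpotent G] (hp : p.Prime)
    (h : _root_.commutator G ≤ (⊤ : Subgroup G).powClosure (powerfulExponent p)) :
    ⁅(⊤ : Subgroup G).powClosure p, (⊤ : Subgroup G)⁆ ≤
      ((⊤ : Subgroup G).powClosure p).powClosure (powerfulExponent p) := by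
  apply le_of_le_sup_commutator_top
  set P := (⊤ : Subgroup G).powClosure p
  set D := P.powClosure (powerfulExponent p) ⊔ ⁅⁅P, (⊤ : Subgroup G)⁆, (⊤ : Subgroup G)⁆
  have hker := QuotientGroup.ker_mk' D
  set f := QuotientGroup.mk' D
  have htop : (⊤ : Subgroup G).map f = ⊤ :=
    map_top_of_surjective _ (QuotientGroup.mk'_surjective D)
  have hP' : P.map f = (⊤ : Subgroup (G ⧸ D)).powClosure p := by
    rw [← htop, ← map_powClosure]
  rw [← hker, ← map_eq_bot_iff, map_commutator, htop, hP']
  apply commutator_powClosure_eq_bot hp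
  · have := map_mono (f := f) h
    rwa [_root_.commutator_def G, map_commutator, map_powClosure, htop] at this
  · have : (P.powClosure (powerfulExponent p)).map f = ⊥ := by
      rw [map_eq_bot_iff, hker]; exact le_sup_left
    rwa [map_powClosure, hP'] at this
  · have : (⁅⁅P, (⊤ : Subgroup G)⁆, (⊤ : Subgroup G)⁆).map f = ⊥ := by
      rw [map_eq_bot_iff, hker]; exact le_sup_right
    rwa [map_commutator, map_commutator, htop, hP',
      commutator_top_right_eq_bot_iff_le_center] at this

end Subgroup

namespace IsPGroup

variable {p : ℕ} {G : Type} [Group G] [Finite G]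

/-- In a powerful `p`-group `G`, the `p`-th power map induces a homomorphism from `G` to
`G / (G^p)^p`. -/
theorem mk_mul_pow_of_powerful (hp : p.Prime) (hG : IsPGroup p G)
    (h : _root_.commutator G ≤ (⊤ : Subgroup G).powClosure (powerfulExponent p)) (x y : G) :
    QuotientGroup.mk' (((⊤ : Subgroup G).powClosure p).powClosure p) ((x * y) ^ p) =
      QuotientGroup.mk' _ (x ^ p) * QuotientGroup.mk' _ (y ^ p) := by
  have := Fact.mk hp
  have := hG.isNilpotent
  set P := (⊤ : Subgroup G).powClosure p
  have hR : ⁅P, (⊤ : Subgroup G)⁆ ≤ P.powClosure p :=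
    (commutator_powClosure_le hp h).trans (powClosure_powerfulExponent_le _ _)
  have hyx : ⁅y, x⁆ ∈ (⊤ : Subgroup G).powClosure (powerfulExponent p) :=
    h (commutator_mem_commutator (H₁ := ⊤) (H₂ := ⊤) (mem_top y) (mem_top x))
  have hyxP : ⁅y, x⁆ ∈ P := powClosure_powerfulExponent_le _ _ hyx
  have hker := QuotientGroup.ker_mk' (P.powClosure p)
  have hsurj := QuotientGroup.mk'_surjective (P.powClosure p)
  set f := QuotientGroup.mk' (P.powClosure p)
  have hf : ∀ g ∈ P.powClosure p, f g = 1 := fun g hg => by rwa [← MonoidHom.mem_ker, hker]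
  have hc : f ⁅y, x⁆ ∈ center _ := by
    refine mem_center_iff.2 fun q => ?_
    obtain ⟨g, rfl⟩ := hsurj q
    have := hf _ (hR (commutator_mem_commutator hyxP (mem_top g)))
    rw [map_commutatorElement, commutatorElement_eq_one_iff_mul_comm] at this
    exact this.symm
  have hz : f ⁅y, x⁆ ^ p.choose 2 = 1 := by
    by_cases h2 : p = 2
    · subst h2
      rw [Nat.choose_self, pow_one]
      exact hf _ (powClosure_mul_le ⊤ 2 2 hyx)
    · apply pow_choose_two_eq_one hp h2
      rw [← map_pow]
      exact hf _ (pow_mem_powClosure hyxP p)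
  have hxy := mul_eq_commutatorElement_mul (f x) (f y)
  rw [← map_commutatorElement] at hxy
  rw [map_pow, map_mul, mul_pow_of_mul_comm_eq_center_mul hc hxy, hz, one_mul, map_pow, map_pow]

theorem relIndex_pFrattini_le (hp : p.Prime) (hG : IsPGroup p G)
    (h : _root_.commutator G ≤ (⊤ : Subgroup G).powClosure (powerfulExponent p)) (H : Subgroup G) :
    (H.pFrattini p).relIndex H ≤ ((⊤ : Subgroup G).pFrattini p).index := by
  induction hn : Nat.card G using Nat.strong_induction_on generalizing G with
  | _ n ih =>
  subst hn
  have := Fact.mk hp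
  have := hG.isNilpotent
  have hfin : ∀ A B : Subgroup G, A.relIndex B ≠ 0 := fun A B =>
    FiniteIndex.index_ne_zero (H := A.subgroupOf B)
  have hΦ : (⊤ : Subgroup G).pFrattini p = (⊤ : Subgroup G).powClosure p :=
    sup_eq_right.2 (h.trans (powClosure_powerfulExponent_le _ _))
  have hmk := hG.mk_mul_pow_of_powerful hp h
  have hPG := commutator_powClosure_le hp h
  rcases eq_or_ne ((⊤ : Subgroup G).pFrattini p) ⊤ with htop | htop
  · have hbot : (⊥ : Subgroup G) = ⊤ := hG.eq_top_of_sup_pFrattini hp (by rw [htop, bot_sup_eq])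
    have hle : H ≤ H.pFrattini p := (le_top.trans hbot.ge).trans bot_le
    rw [relIndex_eq_one.2 hle]
    exact Nat.one_le_iff_ne_zero.2 FiniteIndex.index_ne_zero
  rw [hΦ] at htop ⊢
  set P := (⊤ : Subgroup G).powClosure p
  have hPP : ⁅P, P⁆ ≤ P.powClosure (powerfulExponent p) :=
    (commutator_mono le_rfl le_top).trans hPG
  have hΦP : P.pFrattini p = P.powClosure p :=
    sup_eq_right.2 (hPP.trans (powClosure_powerfulExponent_le _ _))
  have hcard : Nat.card P < Nat.card G :=
    lt_of_le_of_ne P.card_le_card_group fun he => htop (P.eq_top_of_card_eq he)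
  have htopP : (⊤ : Subgroup P).map P.subtype = P := by
    rw [← MonoidHom.range_eq_map, P.range_subtype]
  have key : ((H ⊓ P).pFrattini p).relIndex (H ⊓ P) ≤ (P.powClosure p).relIndex P := by
    have hpow : _root_.commutator P ≤ (⊤ : Subgroup P).powClosure (powerfulExponent p) := by
      rw [← map_subtype_le_map_subtype, map_powClosure, htopP, map_subtype_commutator]
      exact hPP
    have := ih _ hcard (hG.to_subgroup P) hpow (H.subgroupOf P) rfl
    rwa [← relIndex_top_right, ← relIndex_map_map_of_injective _ _ P.subtype_injective,
      map_pFrattini, subgroupOf_map_subtype,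
      ← relIndex_map_map_of_injective _ ⊤ P.subtype_injective, map_pFrattini, htopP, hΦP] at this
  let ψ : G →* G ⧸ P.powClosure p := MonoidHom.mk' (fun x => QuotientGroup.mk' _ (x ^ p)) hmk
  have hψ : ∀ x, ψ x = QuotientGroup.mk' (P.powClosure p) (x ^ p) := fun _ => rfl
  have hPker : P ≤ ψ.ker := fun x hx => by
    rw [MonoidHom.mem_ker, hψ, ← MonoidHom.mem_ker, QuotientGroup.ker_mk']
    exact pow_mem_powClosure hx p
  have hrange : ψ.ker.index = (P.powClosure p).relIndex P := by
    have : ψ.range = P.map (QuotientGroup.mk' (P.powClosure p)) := by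
      apply le_antisymm
      · rintro _ ⟨x, rfl⟩
        exact ⟨x ^ p, pow_mem_powClosure (mem_top x) p, rfl⟩
      · exact map_le_iff_le_comap.2 <| powClosure_le.2 fun x _ => ⟨x, rfl⟩
    rw [index_ker, this, ← relIndex_ker, QuotientGroup.ker_mk']
  set L := H.powClosure p ⊔ (H ⊓ P).pFrattini p
  have hLH : L ≤ H.pFrattini p := sup_le le_sup_right (pFrattini_mono p inf_le_left)
  have hLK : L ≤ H ⊓ P :=
    sup_le (le_inf (powClosure_le_self H p) (powClosure_mono le_top p)) (pFrattini_le_self p _)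
  have hs : ψ.ker.relIndex H ≤ ((H ⊓ P).pFrattini p).relIndex L := by
    have h1 : ψ.ker.relIndex H ≤ (P.powClosure p).relIndex L := by
      have h2 := relIndex_ker L (QuotientGroup.mk' (P.powClosure p))
      rw [QuotientGroup.ker_mk'] at h2
      rw [relIndex_ker, h2]
      refine card_le_of_le ?_
      rintro _ ⟨x, hx, rfl⟩
      exact ⟨x ^ p, mem_sup_left (pow_mem_powClosure hx p), rfl⟩
    exact h1.trans (relIndex_le_of_le_left (hΦP ▸ pFrattini_mono p inf_le_right) (hfin _ _))
  have hu : P.relIndex H ≤ P.relIndex ψ.ker * ψ.ker.relIndex H := by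
    rw [← inf_relIndex_left, ← relIndex_mul_relIndex (H ⊓ P) (H ⊓ ψ.ker) H
      (inf_le_inf_left H hPker) inf_le_left, inf_relIndex_left]
    refine Nat.mul_le_mul_right _ ?_
    have : (H ⊓ P).relIndex (H ⊓ ψ.ker) = P.relIndex (H ⊓ ψ.ker) := by
      rw [← inf_relIndex_right P, ← inf_relIndex_right (H ⊓ P)]
      congr 1
      ext x
      simp only [mem_inf]
      tauto
    rw [this]
    exact relIndex_le_of_le_right inf_le_right (hfin _ _)
  calc (H.pFrattini p).relIndex H ≤ L.relIndex H := relIndex_le_of_le_left hLH (hfin _ _)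
    _ = L.relIndex (H ⊓ P) * P.relIndex H := by
      rw [← relIndex_mul_relIndex L (H ⊓ P) H hLK inf_le_left, inf_relIndex_left]
    _ ≤ L.relIndex (H ⊓ P) * (P.relIndex ψ.ker * ((H ⊓ P).pFrattini p).relIndex L) :=
      Nat.mul_le_mul_left _ (hu.trans (Nat.mul_le_mul_left _ hs))
    _ = P.relIndex ψ.ker * ((H ⊓ P).pFrattini p).relIndex (H ⊓ P) := by
      rw [← relIndex_mul_relIndex _ L (H ⊓ P) le_sup_right hLK]
      ring
    _ ≤ P.relIndex ψ.ker * ψ.ker.index := Nat.mul_le_mul_left _ (key.trans_eq hrange.symm)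
    _ = P.index := relIndex_mul_index hPker

end IsPGroup

/-- If `G` is a finite powerful `p`-group and `H ≤ G`, then the minimal number of
generators of `H` is at most the minimal number of generators of `G`. -/
theorem rank_le_of_powerful
    (p : ℕ) (hp : p.Prime) (G : Type) [Group G] [Finite G]
    (hG : IsPGroup p G) (hpowerful : IsPowerful p G) (H : Subgroup G) :
    Group.rank H ≤ Group.rank G := by
  have h : _root_.commutator G ≤ (⊤ : Subgroup G).powClosure (powerfulExponent p) := by
    have hpow : ∀ n, powerSubgroup G n = (⊤ : Subgroup G).powClosure n := fun n => by
      simp [powerSubgroup, powClosure, Set.range]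
    unfold IsPowerful at hpowerful
    unfold powerfulExponent
    split_ifs at hpowerful ⊢ <;> rwa [← hpow]
  have hH := (hG.to_subgroup H).pow_rank_eq_index_pFrattini hp
  rw [← relIndex_top_right, ← relIndex_map_map_of_injective _ _ H.subtype_injective,
    map_pFrattini, ← MonoidHom.range_eq_map, H.range_subtype] at hH
  rw [← Nat.pow_le_pow_iff_right hp.one_lt, hH, hG.pow_rank_eq_index_pFrattini hp]
  exact hG.relIndex_pFrattini_le hp h H
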